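/- Let (R, m, k) be a commutative noetherian local ring and let n ≥ 1. Then R is Tor-persistent if and only if the localization R[X_1, …, X_n]_{(m, X_1, …, X_n)} of the polynomial ring R[X_1, …, X_n] at the maximal ideal (m, X_1, …, X_n) is Tor-persistent. -/

import Mathlib

open CategoryTheory CategoryTheory.Limits

universe u

/-- An `R`-module `M` has finite projective dimension if it admits a projective
resolution that vanishes in all sufficiently high degrees. -/
def HasFiniteProjDim (R : Type u) [CommRing R] (M : ModuleCat.{u} R) : Prop :=
  ∃ (n : ℕ) (P : CategoryTheory.ProjectiveResolution M),
    ∀ i, n < i → IsZero (P.complex.X i)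

/-- A commutative ring `R` is Tor-persistent if every finitely generated `R`-module `M`
with `Tor_i^R(M, M) = 0` for all sufficiently large `i` has finite projective dimension. -/
def TorPersistent (R : Type u) [CommRing R] : Prop :=
  ∀ M : ModuleCat.{u} R, Module.Finite R M →
    (∃ N : ℕ, ∀ i, N ≤ i → Subsingleton (((Tor (ModuleCat.{u} R) i).obj M).obj M)) →
    HasFiniteProjDim R M

open TensorProduct

lemma ChainComplex.quasiIso_toSingle₀Equiv_symm {C : Type*} [Category* C] [Abelian C]
    (P : ChainComplex C ℕ) {X : C} (π : P.X 0 ⟶ X) [Epi π] (w : P.d 1 0 ≫ π = 0)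
    (h₀ : (ShortComplex.mk _ _ w).Exact) (h : ∀ i, P.ExactAt (i + 1)) :
    QuasiIso ((ChainComplex.toSingle₀Equiv P X).symm ⟨π, w⟩) :=
  ⟨fun n => by
    cases n
    · rw [ChainComplex.quasiIsoAt₀_iff, ShortComplex.quasiIso_iff_of_zeros']
      · refine (ShortComplex.exact_and_epi_g_iff_of_iso ?_).2 ⟨h₀, inferInstanceAs (Epi π)⟩
        exact ShortComplex.isoMk (Iso.refl _) (Iso.refl _) (Iso.refl X)
          ((Category.id_comp _).trans (Category.comp_id _).symm)
          ((Category.id_comp π).trans ((ChainComplex.toSingle₀Equiv_symm_apply_f_zero π w).symm.trans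
            (Category.comp_id _).symm))
      · exact P.shape _ _ (by simp)
      all_goals rfl
    · rw [quasiIsoAt_iff_exactAt']
      · apply h
      · apply ChainComplex.exactAt_succ_single_obj⟩

/-- A sequence of short exact sequences `0 ⟶ K (i + 1) ⟶ F i ⟶ K i ⟶ 0` with all `F i`
projective, that is, a projective resolution of `K 0` together with its syzygies. -/
structure SyzygySeq (A : Type u) [CommRing A] where
  /-- the syzygies -/
  K : ℕ → ModuleCat.{u} A
  /-- the projective modules -/
  F : ℕ → ModuleCat.{u} A
  /-- the inclusion of a syzygy -/
  g : ∀ i, K (i + 1) →ₗ[A] F i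
  /-- the projection onto a syzygy -/
  f : ∀ i, F i →ₗ[A] K i
  inj : ∀ i, Function.Injective (g i)
  surj : ∀ i, Function.Surjective (f i)
  exact : ∀ i, Function.Exact (g i) (f i)
  proj : ∀ i, Module.Projective A (F i)

namespace SyzygySeq

variable {A : Type u} [CommRing A] (S : SyzygySeq A)

attribute [instance] SyzygySeq.proj

/-- Drop the first short exact sequence. -/
@[simps]
def tail : SyzygySeq A where
  K i := S.K (i + 1)
  F i := S.F (i + 1)
  g i := S.g (i + 1)
  f i := S.f (i + 1)
  inj i := S.inj (i + 1)
  surj i := S.surj (i + 1)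
  exact i := S.exact (i + 1)
  proj i := S.proj (i + 1)

/-- The short complex `K (i + 1) ⟶ F i ⟶ K i`. -/
abbrev shortComplex (i : ℕ) : ShortComplex (ModuleCat.{u} A) where
  X₁ := S.K (i + 1)
  X₂ := S.F i
  X₃ := S.K i
  f := ModuleCat.ofHom (S.g i)
  g := ModuleCat.ofHom (S.f i)
  zero := by ext x; exact (S.exact i).apply_apply_eq_zero x

lemma shortExact_shortComplex (i : ℕ) : (S.shortComplex i).ShortExact where
  exact := (ShortComplex.ShortExact.moduleCat_exact_iff_function_exact _).2 (S.exact i)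
  mono_f := (ModuleCat.mono_iff_injective _).2 (S.inj i)
  epi_g := (ModuleCat.epi_iff_surjective _).2 (S.surj i)

lemma hasProjectiveDimensionLT_iff (n : ℕ) :
    HasProjectiveDimensionLT (S.K 0) (n + 1) ↔ Module.Projective A (S.K n) := by
  induction n generalizing S with
  | zero =>
    rw [IsProjective.iff_projective, projective_iff_hasProjectiveDimensionLT_one]
  | succ n ih =>
    have : Projective (S.F 0) := (IsProjective.iff_projective _).1 (S.proj 0)
    rw [(S.shortExact_shortComplex 0).hasProjectiveDimensionLT_X₃_iff n this]
    exact ih S.tail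

/-- The differentials of the projective resolution of `K 0`. -/
abbrev d (i : ℕ) : S.F (i + 1) →ₗ[A] S.F i := S.g i ∘ₗ S.f (i + 1)

/-- The chain complex of projective modules of a sequence of syzygies. -/
noncomputable def complex : ChainComplex (ModuleCat.{u} A) ℕ :=
  ChainComplex.of S.F (fun i ↦ ModuleCat.ofHom (S.d i)) fun i ↦ by
    ext x
    simp [(S.exact (i + 1)).apply_apply_eq_zero]

lemma complex_d (i : ℕ) :
    S.complex.d (i + 1) i = ModuleCat.ofHom (S.d i) :=
  ChainComplex.of_d S.F (fun i ↦ ModuleCat.ofHom (S.d i)) i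

lemma exact_d (i : ℕ) : Function.Exact (S.d (i + 1)) (S.d i) := by
  intro x
  simp only [LinearMap.comp_apply, map_eq_zero_iff _ (S.inj i)]
  rw [S.exact (i + 1) x]
  exact ((S.surj (i + 2)).exists (p := fun y ↦ S.g (i + 1) y = x))

lemma complex_exactAt_succ (i : ℕ) : S.complex.ExactAt (i + 1) := by
  rw [HomologicalComplex.exactAt_iff' _ (i + 2) (i + 1) i (by simp) (by simp),
    ShortComplex.ShortExact.moduleCat_exact_iff_function_exact]
  change Function.Exact (S.complex.d (i + 2) (i + 1)) (S.complex.d (i + 1) i)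
  rw [S.complex_d, S.complex_d]
  exact S.exact_d i

/-- The augmentation of the projective resolution of `K 0`. -/
def ε : S.complex.X 0 ⟶ S.K 0 := ModuleCat.ofHom (S.f 0)

lemma exact_d_f : Function.Exact (S.d 0) (S.f 0) := by
  intro x
  rw [S.exact 0 x]
  exact ((S.surj 1).exists (p := fun y ↦ S.g 0 y = x))

lemma complex_d_comp_ε : S.complex.d 1 0 ≫ S.ε = 0 := by
  rw [complex_d]
  ext x
  exact S.exact_d_f.apply_apply_eq_zero x

/-- The projective resolution of `K 0` given by a sequence of syzygies. -/
noncomputable def resolution : ProjectiveResolution (S.K 0) where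
  complex := S.complex
  projective i := (IsProjective.iff_projective _).1 (S.proj i)
  π := (ChainComplex.toSingle₀Equiv _ _).symm ⟨S.ε, S.complex_d_comp_ε⟩
  quasiIso := by
    have : Epi S.ε := (ModuleCat.epi_iff_surjective _).2 (S.surj 0)
    refine S.complex.quasiIso_toSingle₀Equiv_symm _ _ ?_ S.complex_exactAt_succ
    rw [ShortComplex.ShortExact.moduleCat_exact_iff_function_exact]
    change Function.Exact (S.complex.d 1 0) S.ε
    rw [S.complex_d]
    exact S.exact_d_f

lemma exists_of_module [IsNoetherianRing A] (M : ModuleCat.{u} A) : ∃ S : SyzygySeq A, S.K 0 = M ∧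
    (∀ i, Module.Projective A (S.K i) → Subsingleton (S.K (i + 1))) ∧
    (Module.Finite A M → ∀ i, Module.Finite A (S.K i)) := by
  have cover (M : ModuleCat.{u} A) : ∃ (F : ModuleCat.{u} A) (f : F →ₗ[A] M),
      Module.Projective A F ∧ Function.Surjective f ∧
      (Module.Projective A M → Function.Injective f) ∧
      (Module.Finite A M → Module.Finite A F) := by
    by_cases hM : Module.Projective A M
    · exact ⟨M, .id, hM, Function.surjective_id, fun _ ↦ Function.injective_id, id⟩
    by_cases hM' : Module.Finite A M
    · obtain ⟨n, f, hf⟩ := Module.Finite.exists_fin' A M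
      exact ⟨.of A (Fin n → A), f, inferInstanceAs (Module.Projective A (Fin n → A)), hf,
        fun h ↦ (hM h).elim, fun _ ↦ inferInstanceAs (Module.Finite A (Fin n → A))⟩
    · exact ⟨.of A (M →₀ A), Finsupp.linearCombination A id,
        inferInstanceAs (Module.Projective A (M →₀ A)), Finsupp.linearCombination_id_surjective A M,
        fun h ↦ (hM h).elim, fun h ↦ (hM' h).elim⟩
  choose F f hF hf hproj hfin using cover
  let ker (M : ModuleCat.{u} A) : ModuleCat.{u} A := .of A (LinearMap.ker (f M))
  let g (M : ModuleCat.{u} A) : ker M →ₗ[A] F M := (LinearMap.ker (f M)).subtype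
  have hexact (M : ModuleCat.{u} A) : Function.Exact (g M) (f M) :=
    LinearMap.exact_subtype_ker_map (f M)
  have hker (M : ModuleCat.{u} A) (hM : Module.Projective A M) : Subsingleton (ker M) :=
    Submodule.subsingleton_iff_eq_bot.2 (LinearMap.ker_eq_bot.2 (hproj M hM))
  have hker' (M : ModuleCat.{u} A) (hM : Module.Finite A M) : Module.Finite A (ker M) := by
    have := hfin M hM
    exact inferInstanceAs (Module.Finite A (LinearMap.ker (f M)))
  let K : ℕ → ModuleCat.{u} A := Nat.rec M fun _ ↦ ker
  let S : SyzygySeq A :=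
    { K := K
      F i := F (K i)
      g i := g (K i)
      f i := f (K i)
      inj i := Subtype.val_injective
      surj i := hf (K i)
      exact i := hexact (K i)
      proj i := hF (K i) }
  refine ⟨S, rfl, fun i hi ↦ hker _ hi, fun hM i ↦ ?_⟩
  induction i with
  | zero => exact hM
  | succ i ih => exact hker' _ ih

end SyzygySeq

namespace SyzygySeq

variable {A : Type u} [CommRing A] (S : SyzygySeq A)

lemma isZero_resolution_X {i : ℕ} (hi : Subsingleton (S.K i)) (hi' : Subsingleton (S.K (i + 1))) :
    IsZero (S.resolution.complex.X i) := by
  refine (ModuleCat.isZero_iff_subsingleton (M := S.F i)).2 ⟨fun x y ↦ ?_⟩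
  obtain ⟨x, rfl⟩ := (S.exact i x).1 (Subsingleton.elim _ _)
  obtain ⟨y, rfl⟩ := (S.exact i y).1 (Subsingleton.elim _ _)
  rw [Subsingleton.elim x y]

end SyzygySeq

lemma hasFiniteProjDim_iff_hasProjectiveDimensionLT {A : Type u} [CommRing A] [IsNoetherianRing A]
    (M : ModuleCat.{u} A) :
    HasFiniteProjDim A M ↔ ∃ n : ℕ, HasProjectiveDimensionLT M (n + 1) := by
  constructor
  · rintro ⟨n, P, hP⟩
    refine ⟨n, HasProjectiveDimensionLT.mk fun i hi Y e ↦ ?_⟩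
    obtain ⟨f, hf, rfl⟩ := P.extMk_surjective e (i + 1) rfl
    obtain rfl : f = 0 := (hP i hi).eq_of_src _ _
    exact P.extMk_zero _ _
  · rintro ⟨n, hn⟩
    obtain ⟨S, rfl, hS, -⟩ := SyzygySeq.exists_of_module M
    rw [S.hasProjectiveDimensionLT_iff] at hn
    have key (i : ℕ) (hi : n < i) : Subsingleton (S.K i) := by
      induction i, hi using Nat.le_induction with
      | base => exact hS n hn
      | succ i _ ih => exact hS i inferInstance
    exact ⟨n, S.resolution, fun i hi ↦ S.isZero_resolution_X (key i hi) (key _ (by lia))⟩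

namespace SyzygySeq

variable {A : Type u} [CommRing A] (S : SyzygySeq A)

lemma hasFiniteProjDim_iff [IsNoetherianRing A] :
    HasFiniteProjDim A (S.K 0) ↔ ∃ n, Module.Projective A (S.K n) := by
  simp_rw [hasFiniteProjDim_iff_hasProjectiveDimensionLT, S.hasProjectiveDimensionLT_iff]

lemma exact_lTensor_d_iff (M : Type u) [AddCommGroup M] [Module A M] (i : ℕ) :
    Function.Exact ((S.d (i + 1)).lTensor M) ((S.d i).lTensor M) ↔
      Function.Injective ((S.g i).lTensor M) := by
  have hf (i : ℕ) := LinearMap.lTensor_surjective M (S.surj i)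
  have he := lTensor_exact M (S.exact (i + 1)) (S.surj (i + 1))
  simp only [LinearMap.lTensor_comp]
  constructor
  · intro h
    rw [injective_iff_map_eq_zero]
    intro x hx
    obtain ⟨x, rfl⟩ := hf (i + 1) x
    obtain ⟨y, rfl⟩ := (h x).1 hx
    exact he.apply_apply_eq_zero _
  · intro h x
    simp only [LinearMap.comp_apply, map_eq_zero_iff _ h]
    rw [he x]
    exact ((hf (i + 2)).exists (p := fun y ↦ (S.g (i + 1)).lTensor M y = x))

lemma subsingleton_tor_succ_iff (M : ModuleCat.{u} A) (i : ℕ) :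
    Subsingleton (((Tor (ModuleCat.{u} A) (i + 1)).obj M).obj (S.K 0)) ↔
      Function.Injective ((S.g i).lTensor M) := by
  rw [← ModuleCat.isZero_iff_subsingleton, Tor_obj,
    (S.resolution.isoLeftDerivedObj ((MonoidalCategory.tensoringLeft _).obj M) (i + 1)).isZero_iff,
    ← exact_lTensor_d_iff]
  change IsZero (HomologicalComplex.homology _ _) ↔ _
  rw [← HomologicalComplex.exactAt_iff_isZero_homology,
    HomologicalComplex.exactAt_iff' _ (i + 2) (i + 1) i (by simp) (by simp),
    ShortComplex.ShortExact.moduleCat_exact_iff_function_exact]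
  change Function.Exact
    (MonoidalCategory.whiskerLeft M (S.complex.d (i + 2) (i + 1)))
    (MonoidalCategory.whiskerLeft M (S.complex.d (i + 1) i)) ↔ _
  rw [S.complex_d, S.complex_d]
  rfl

end SyzygySeq

section TensorProduct

variable {A : Type*} [CommRing A]

/-- If `F'` is flat, then the vanishing of the first `Tor` of `M` and `M'` computed by
resolving `M'` implies the vanishing of the one computed by resolving `M`. -/
lemma rTensor_injective_of_lTensor_injective {K F M K' F' M' : Type*}
    [AddCommGroup K] [AddCommGroup F] [AddCommGroup M] [AddCommGroup K'] [AddCommGroup F']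
    [AddCommGroup M'] [Module A K] [Module A F] [Module A M] [Module A K'] [Module A F']
    [Module A M'] [Module.Flat A F'] {g : K →ₗ[A] F} {f : F →ₗ[A] M} {g' : K' →ₗ[A] F'}
    {f' : F' →ₗ[A] M'} (hg : Function.Injective g) (hgf : Function.Exact g f)
    (hf : Function.Surjective f) (hgf' : Function.Exact g' f') (hf' : Function.Surjective f')
    (h : Function.Injective (g'.lTensor M)) : Function.Injective (g.rTensor M') := by
  rw [injective_iff_map_eq_zero]
  intro x hx
  obtain ⟨y, rfl⟩ := LinearMap.lTensor_surjective K hf' x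
  obtain ⟨z, hz⟩ := (lTensor_exact F hgf' hf' (g.rTensor F' y)).1 (by
    rwa [← LinearMap.comp_apply, LinearMap.lTensor_comp_rTensor, ← LinearMap.rTensor_comp_lTensor])
  obtain ⟨w, rfl⟩ := (rTensor_exact K' hgf hf z).1 (by
    apply h
    rw [map_zero, ← LinearMap.comp_apply, LinearMap.lTensor_comp_rTensor,
      ← LinearMap.rTensor_comp_lTensor, LinearMap.comp_apply, hz]
    exact (rTensor_exact F' hgf hf).apply_apply_eq_zero y)
  rw [← LinearMap.comp_apply, LinearMap.lTensor_comp_rTensor, ← LinearMap.rTensor_comp_lTensor,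
    LinearMap.comp_apply] at hz
  rw [← Module.Flat.rTensor_preserves_injective_linearMap g hg hz]
  exact (lTensor_exact K hgf' hf').apply_apply_eq_zero w

lemma tmul_quotient_span_singleton_eq_zero_iff {M : Type*} [AddCommGroup M] [Module A M] {x : A}
    {m : M} : (1 : A ⧸ Ideal.span {x}) ⊗ₜ[A] m = 0 ↔ ∃ m', x • m' = m := by
  change m ∈ LinearMap.ker (TensorProduct.mk A (A ⧸ Ideal.span {x}) M 1) ↔ _
  simp [LinearMap.ker_tensorProductMk, Submodule.ideal_span_singleton_smul,
    Submodule.mem_smul_pointwise_iff_exists]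

lemma baseChange_quotient_span_singleton_injective {U V W : Type*} [AddCommGroup U]
    [AddCommGroup V] [AddCommGroup W] [Module A U] [Module A V] [Module A W] {x : A}
    {g : U →ₗ[A] V} {f : V →ₗ[A] W} (hg : Function.Injective g) (hgf : Function.Exact g f)
    (hx : IsSMulRegular W x) : Function.Injective (g.baseChange (A ⧸ Ideal.span {x})) := by
  rw [injective_iff_map_eq_zero]
  intro u hu
  obtain ⟨u, rfl⟩ := TensorProduct.mk_surjective A U (A ⧸ Ideal.span {x})
    Ideal.Quotient.mk_surjective u
  rw [TensorProduct.mk_apply, LinearMap.baseChange_tmul,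
    tmul_quotient_span_singleton_eq_zero_iff] at hu
  obtain ⟨v, hv⟩ := hu
  have hfv : f v = 0 := hx (by
    simp [← map_smul, hv, hgf.apply_apply_eq_zero])
  obtain ⟨u', rfl⟩ := (hgf v).1 hfv
  exact tmul_quotient_span_singleton_eq_zero_iff.2 ⟨u', hg (by simp [hv])⟩

lemma lTensor_baseChange_injective {B M N P : Type*} [CommRing B] [Algebra A B] [AddCommGroup M]
    [AddCommGroup N] [AddCommGroup P] [Module A M] [Module A N] [Module A P] {g : N →ₗ[A] P}
    (h : Function.Injective ((g.lTensor M).baseChange B)) :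
    Function.Injective ((g.baseChange B).lTensor (B ⊗[A] M)) := by
  let e := AlgebraTensorModule.distribBaseChange A B M N
  let e' := AlgebraTensorModule.distribBaseChange A B M P
  have : (g.baseChange B).lTensor (B ⊗[A] M) ∘ₗ e.toLinearMap =
      e'.toLinearMap ∘ₗ (g.lTensor M).baseChange B := by
    ext; simp [e, e']
  refine (Function.Injective.of_comp_iff' _ e.bijective).1 ?_
  have h' : Function.Injective (e' ∘ (g.lTensor M).baseChange B) := e'.injective.comp h
  convert h'
  exact congrArg DFunLike.coe this

end TensorProduct

namespace SyzygySeq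

variable {A : Type u} [CommRing A] (S : SyzygySeq A)

/-- The base change of a sequence of syzygies to an algebra over which it remains exact. -/
@[simps]
noncomputable def baseChange (B : Type u) [CommRing B] [Algebra A B]
    (h : ∀ i, Function.Injective ((S.g i).baseChange B)) : SyzygySeq B where
  K i := .of B (B ⊗[A] S.K i)
  F i := .of B (B ⊗[A] S.F i)
  g i := (S.g i).baseChange B
  f i := (S.f i).baseChange B
  inj := h
  surj i := LinearMap.lTensor_surjective B (S.surj i)
  exact i := lTensor_exact B (S.exact i) (S.surj i)
  proj i := inferInstanceAs (Module.Projective B (B ⊗[A] S.F i))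

end SyzygySeq

lemma TorPersistent.exists_projective {B : Type u} [CommRing B] [IsNoetherianRing B]
    (hB : TorPersistent B) (S : SyzygySeq B) (hS : Module.Finite B (S.K 0)) (N : ℕ)
    (h : ∀ i, N ≤ i → Function.Injective ((S.g i).lTensor (S.K 0))) :
    ∃ n, Module.Projective B (S.K n) := by
  refine S.hasFiniteProjDim_iff.1 (hB _ hS ⟨N + 1, fun i hi ↦ ?_⟩)
  obtain ⟨i, rfl⟩ := Nat.exists_eq_add_one_of_ne_zero (show i ≠ 0 by lia)
  exact (S.subsingleton_tor_succ_iff _ i).2 (h i (by lia))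

lemma TorPersistent.exists_projective_baseChange {A B : Type u} [CommRing A] [CommRing B]
    [IsNoetherianRing B] [Algebra A B] (hB : TorPersistent B) (S : SyzygySeq A)
    (hS : Module.Finite A (S.K 0)) (hS' : ∀ i, Function.Injective ((S.g i).baseChange B)) (N : ℕ)
    (h : ∀ i, N ≤ i → Function.Injective (((S.g i).lTensor (S.K 0)).baseChange B)) :
    ∃ n, Module.Projective B (B ⊗[A] S.K n) :=
  hB.exists_projective (S.baseChange B hS') (inferInstanceAs (Module.Finite B (B ⊗[A] S.K 0))) N
    fun i hi ↦ lTensor_baseChange_injective (h i hi)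

lemma torPersistent_of_syzygySeq {A : Type u} [CommRing A] [IsNoetherianRing A]
    (h : ∀ S : SyzygySeq A, (∀ i, Module.Finite A (S.K i)) → ∀ N : ℕ,
      (∀ i, N ≤ i → Function.Injective ((S.g i).lTensor (S.K 0))) →
      ∃ n, Module.Projective A (S.K n)) : TorPersistent A := by
  rintro M hM ⟨N, hN⟩
  obtain ⟨S, rfl, -, hS⟩ := SyzygySeq.exists_of_module M
  exact S.hasFiniteProjDim_iff.2 (h S (hS hM) N fun i hi ↦
    (S.subsingleton_tor_succ_iff _ i).1 (hN _ (by lia)))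

lemma TorPersistent.of_flat_of_retraction {R B : Type u} [CommRing R] [CommRing B]
    [IsNoetherianRing R] [IsNoetherianRing B] [Algebra R B] [Module.Flat R B] (φ : B →ₐ[R] R)
    (hB : TorPersistent B) : TorPersistent R := by
  refine torPersistent_of_syzygySeq fun S hS N h ↦ ?_
  obtain ⟨n, hn⟩ := hB.exists_projective_baseChange S (hS 0)
    (fun i ↦ Module.Flat.lTensor_preserves_injective_linearMap _ (S.inj i)) N
    (fun i hi ↦ Module.Flat.lTensor_preserves_injective_linearMap _ (h i hi))
  refine ⟨n, ?_⟩
  let _ : Algebra B R := φ.toRingHom.toAlgebra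
  have : IsScalarTower R B R := .of_algebraMap_eq fun r ↦ (φ.commutes r).symm
  exact .of_equiv (AlgebraTensorModule.cancelBaseChange R B R R (S.K n) ≪≫ₗ
    TensorProduct.lid R (S.K n))

lemma TorPersistent.of_ringEquiv {R B : Type u} [CommRing R] [CommRing B]
    [IsNoetherianRing R] [IsNoetherianRing B] (e : R ≃+* B) (hB : TorPersistent B) :
    TorPersistent R := by
  let _ : Algebra R B := e.toRingHom.toAlgebra
  let e' : R ≃ₐ[R] B := .ofRingEquiv (f := e) fun _ ↦ rfl
  have : Module.Flat R B := .of_linearEquiv e'.symm.toLinearEquiv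
  exact hB.of_flat_of_retraction e'.symm.toAlgHom

namespace SyzygySeq

variable {A : Type u} [CommRing A] (S : SyzygySeq A)

lemma isSMulRegular_tensor_K_succ {x : A} (M : Type*) [AddCommGroup M] [Module A M]
    (hx : IsSMulRegular M x) {i : ℕ} (h : Function.Injective ((S.g i).lTensor M)) :
    IsSMulRegular (M ⊗[A] S.K (i + 1)) x :=
  IsSMulRegular.of_injective _ h (hx.rTensor (S.F i))

lemma isSMulRegular_K_succ {x : A} (hx : IsSMulRegular A x) (i : ℕ) :
    IsSMulRegular (S.K (i + 1)) x :=
  IsSMulRegular.of_injective _ (S.inj i)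
    (((TensorProduct.lid A (S.F i)).isSMulRegular_congr x).1 (hx.rTensor (S.F i)))

lemma lTensor_K_one_injective {i : ℕ}
    (h : Function.Injective ((S.g (i + 1)).lTensor (S.K 0))) :
    Function.Injective ((S.g i).lTensor (S.K 1)) := by
  have h₀ := rTensor_injective_of_lTensor_injective (S.inj 0) (S.exact 0) (S.surj 0)
    (S.exact (i + 1)) (S.surj (i + 1)) h
  have h₁ := (Module.Flat.lTensor_preserves_injective_linearMap (M := S.F 0) _ (S.inj i)).comp h₀
  rw [← LinearMap.coe_comp, LinearMap.lTensor_comp_rTensor, ← LinearMap.rTensor_comp_lTensor,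
    LinearMap.coe_comp] at h₁
  exact h₁.of_comp

end SyzygySeq

lemma Module.projective_of_projective_quotient_span_singleton_tensor {A M : Type*} [CommRing A]
    [IsNoetherianRing A] [IsLocalRing A] [AddCommGroup M] [Module A M] [Module.Finite A M] {x : A}
    (hxm : x ∈ IsLocalRing.maximalIdeal A) (hx : IsSMulRegular M x)
    (h : Module.Projective (A ⧸ Ideal.span {x}) ((A ⧸ Ideal.span {x}) ⊗[A] M)) :
    Module.Projective A M := by
  have : Nontrivial (A ⧸ Ideal.span {x}) := Ideal.Quotient.nontrivial_iff.2 fun h ↦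
    (IsLocalRing.mem_maximalIdeal x).1 hxm (Ideal.span_singleton_eq_top.1 h)
  have : IsLocalRing (A ⧸ Ideal.span {x}) :=
    .of_surjective' (Ideal.Quotient.mk _) Ideal.Quotient.mk_surjective
  have := Module.Flat.of_projective (R := A ⧸ Ideal.span {x}) (M := (A ⧸ Ideal.span {x}) ⊗[A] M)
  have : Module.Free (A ⧸ Ideal.span {x}) ((A ⧸ Ideal.span {x}) ⊗[A] M) :=
    Module.free_of_flat_of_isLocalRing
  have : Module.Free (A ⧸ Ideal.span {x}) (QuotSMulTop x M) :=
    .of_equiv ((QuotSMulTop.equivQuotTensor x M).extendScalarsOfSurjective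
      Ideal.Quotient.mk_surjective).symm
  have hxj : x ∈ (⊥ : Ideal A).jacobson := by
    rwa [IsLocalRing.jacobson_eq_maximalIdeal ⊥ bot_ne_top]
  have hfp := Module.finitePresentation_of_finite A M
  have := (Module.free_quotSMulTop_iff_free A M hxj hx).1 ‹_›
  infer_instance

/-- Tor-persistence ascends along the quotient by a regular element. -/
lemma TorPersistent.of_quotient_span_singleton {A : Type u} [CommRing A] [IsNoetherianRing A]
    [IsLocalRing A] {x : A} (hxm : x ∈ IsLocalRing.maximalIdeal A) (hx : IsSMulRegular A x)
    (hB : TorPersistent (A ⧸ Ideal.span {x})) : TorPersistent A := by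
  refine torPersistent_of_syzygySeq fun S hS N h ↦ ?_
  have hS₁ := S.isSMulRegular_K_succ hx
  have hS' (i : ℕ) (hi : N ≤ i) : Function.Injective ((S.g i).lTensor (S.K 1)) :=
    S.lTensor_K_one_injective (h (i + 1) (by lia))
  obtain ⟨n, hn⟩ := hB.exists_projective_baseChange S.tail (hS 1)
    (fun i ↦ baseChange_quotient_span_singleton_injective (S.inj (i + 1)) (S.exact (i + 1))
      (hS₁ i)) N
    (fun i hi ↦ baseChange_quotient_span_singleton_injective (hS' (i + 1) (by lia))
      (lTensor_exact _ (S.exact (i + 1)) (S.surj (i + 1)))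
      (S.isSMulRegular_tensor_K_succ (S.K 1) (hS₁ 0) (hS' i hi)))
  have := hS (n + 1)
  exact ⟨n + 1, Module.projective_of_projective_quotient_span_singleton_tensor hxm (hS₁ n) hn⟩

open RingTheory.Sequence

lemma isWeaklyRegular_quotient_span_singleton {A : Type*} [CommRing A] {x : A} {rs : List A}
    (h : IsWeaklyRegular (QuotSMulTop x A) rs) :
    IsWeaklyRegular (A ⧸ Ideal.span {x}) (rs.map (Ideal.Quotient.mk (Ideal.span {x}))) := by
  let e : QuotSMulTop x A ≃ₗ[A] A ⧸ Ideal.span {x} := Submodule.quotEquivOfEq _ _ (by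
    rw [← Submodule.ideal_span_singleton_smul, smul_eq_mul, Ideal.mul_top])
  exact (isWeaklyRegular_map_algebraMap_iff (A ⧸ Ideal.span {x}) (A ⧸ Ideal.span {x}) rs).2
    ((e.isWeaklyRegular_congr rs).1 h)

/-- Tor-persistence ascends along the quotient by a regular sequence. -/
lemma TorPersistent.of_isWeaklyRegular {A R : Type u} [CommRing A] [IsNoetherianRing A]
    [IsLocalRing A] [CommRing R] {rs : List A} (hrs : ∀ r ∈ rs, r ∈ IsLocalRing.maximalIdeal A)
    (h : IsWeaklyRegular A rs) {φ : A →+* R} (hφ : Function.Surjective φ)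
    (hker : RingHom.ker φ = Ideal.ofList rs) (hR : TorPersistent R) : TorPersistent A := by
  induction hl : rs.length generalizing A with
  | zero =>
    obtain rfl := List.length_eq_zero_iff.1 hl
    have hinj : Function.Injective φ := by
      rw [RingHom.injective_iff_ker_eq_bot, hker, Ideal.ofList_nil]
    have := isNoetherianRing_of_surjective _ _ φ hφ
    exact hR.of_ringEquiv (RingEquiv.ofBijective φ ⟨hinj, hφ⟩)
  | succ n ih =>
    obtain ⟨x, rs, rfl⟩ := List.exists_cons_of_length_eq_add_one hl
    rw [isWeaklyRegular_cons_iff] at h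
    have hx := hrs x List.mem_cons_self
    refine TorPersistent.of_quotient_span_singleton hx h.1 ?_
    have : Nontrivial (A ⧸ Ideal.span {x}) := Ideal.Quotient.nontrivial_iff.2 fun h ↦
      (IsLocalRing.mem_maximalIdeal x).1 hx (Ideal.span_singleton_eq_top.1 h)
    have : IsLocalRing (A ⧸ Ideal.span {x}) :=
      .of_surjective' (Ideal.Quotient.mk _) Ideal.Quotient.mk_surjective
    have hle : Ideal.span {x} ≤ RingHom.ker φ := by simp [hker]
    refine ih (rs := rs.map (Ideal.Quotient.mk (Ideal.span {x}))) ?_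
      (isWeaklyRegular_quotient_span_singleton h.2) (φ := Ideal.Quotient.lift _ φ hle)
      (Ideal.Quotient.lift_surjective_of_surjective _ hle hφ) ?_ (by simpa using hl)
    · simp only [List.mem_map, forall_exists_index, and_imp, forall_apply_eq_imp_iff₂]
      intro r hr
      have : IsLocalHom (Ideal.Quotient.mk (Ideal.span {x})) :=
        .of_surjective _ Ideal.Quotient.mk_surjective
      have := hrs r (List.mem_cons_of_mem _ hr)
      rw [IsLocalRing.mem_maximalIdeal, mem_nonunits_iff] at this ⊢
      exact fun h ↦ this (isUnit_of_map_unit _ _ h)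
    · rw [Ideal.ker_quotient_lift, hker, ← Ideal.map_ofList, Ideal.ofList_cons, Ideal.map_sup,
        Ideal.map_quotient_self, bot_sup_eq]

namespace MvPolynomial

variable {σ R : Type*} [CommRing R]

lemma ofList_map_X (l : List σ) :
    Ideal.ofList (l.map (X : σ → MvPolynomial σ R)) = Ideal.span (X '' {j | j ∈ l}) := by
  simp [Ideal.ofList, Set.image]

lemma isWeaklyRegular_map_X {l : List σ} (hl : l.Nodup) :
    
    IsWeaklyRegular (MvPolynomial σ R) (l.map (X : σ → MvPolynomial σ R)) := by
  rw [isWeaklyRegular_iff]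
  intro i hi
  rw [isSMulRegular_quotient_iff_mem_of_smul_mem, ← List.map_take, ofList_map_X]
  simp only [smul_eq_mul, Ideal.mul_top, List.getElem_map, mem_ideal_span_X_image]
  rw [List.length_map] at hi
  intro p hp m hm
  obtain ⟨j, hj, hmj⟩ := hp (Finsupp.single l[i] 1 + m) (by
    rwa [mem_support_iff, coeff_X_mul, ← mem_support_iff])
  refine ⟨j, hj, fun h ↦ hmj ?_⟩
  obtain ⟨k, hk, rfl⟩ := List.mem_take_iff_getElem.1 hj
  have hne : l[i] ≠ l[k] := by
    rw [ne_eq, hl.getElem_inj_iff]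
    lia
  simp [h, hne]

lemma ker_constantCoeff_eq_span :
    RingHom.ker (constantCoeff (R := R) (σ := σ)) = Ideal.span (Set.range X) := by
  ext p
  rw [← Set.image_univ, mem_ideal_span_X_image, RingHom.mem_ker, constantCoeff_eq]
  refine ⟨fun h m hm ↦ ?_, fun h ↦ ?_⟩
  · have : m ≠ 0 := by
      rintro rfl
      exact mem_support_iff.1 hm h
    simpa using Finsupp.ne_iff.1 this
  · by_contra h0
    simpa using h 0 (mem_support_iff.2 h0)

end MvPolynomial

namespace MvPolynomial

variable {σ R : Type*} [CommRing R] [IsLocalRing R] {I : Ideal (MvPolynomial σ R)}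

lemma X_mem_of_eq_span
    (hI : I = Ideal.span (C '' (IsLocalRing.maximalIdeal R : Set R) ∪ Set.range X)) (i : σ) :
    X i ∈ I :=
  hI ▸ Ideal.subset_span (.inr ⟨i, rfl⟩)

lemma isUnit_constantCoeff_of_notMem
    (hI : I = Ideal.span (C '' (IsLocalRing.maximalIdeal R : Set R) ∪ Set.range X))
    {p : MvPolynomial σ R} (hp : p ∉ I) : IsUnit (constantCoeff p) := by
  by_contra h
  have hC : C (constantCoeff p) ∈ I :=
    hI ▸ Ideal.subset_span (.inl ⟨_, (IsLocalRing.mem_maximalIdeal _).2 h, rfl⟩)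
  have hker : p - C (constantCoeff p) ∈ RingHom.ker (constantCoeff (R := R) (σ := σ)) := by
    simp [RingHom.mem_ker]
  rw [ker_constantCoeff_eq_span] at hker
  have hX : Ideal.span (Set.range X) ≤ I := by
    rw [hI]
    exact Ideal.span_mono Set.subset_union_right
  exact hp (by simpa using add_mem (hX hker) hC)

/-- Evaluation at the origin, on the localization of the polynomial ring over a local ring at
the maximal ideal of the origin. -/
noncomputable def localizationConstantCoeff [I.IsPrime]
    (hI : I = Ideal.span (C '' (IsLocalRing.maximalIdeal R : Set R) ∪ Set.range X)) :
    Localization.AtPrime I →ₐ[R] R :=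
  IsLocalization.liftAlgHom (M := I.primeCompl)
    (f := { constantCoeff with commutes' := constantCoeff_C σ })
    fun p ↦ isUnit_constantCoeff_of_notMem hI p.2

lemma localizationConstantCoeff_algebraMap [I.IsPrime]
    (hI : I = Ideal.span (C '' (IsLocalRing.maximalIdeal R : Set R) ∪ Set.range X))
    (p : MvPolynomial σ R) :
    localizationConstantCoeff hI (algebraMap _ _ p) = constantCoeff p :=
  IsLocalization.lift_eq _ p

lemma ker_localizationConstantCoeff [I.IsPrime]
    (hI : I = Ideal.span (C '' (IsLocalRing.maximalIdeal R : Set R) ∪ Set.range X)) :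
    RingHom.ker (localizationConstantCoeff hI) =
      (Ideal.span (Set.range X)).map (algebraMap (MvPolynomial σ R) (Localization.AtPrime I)) := by
  rw [← ker_constantCoeff_eq_span]
  refine le_antisymm (fun x hx ↦ ?_) (Ideal.map_le_iff_le_comap.2 fun p hp ↦ ?_)
  · obtain ⟨p, s, rfl⟩ := IsLocalization.exists_mk'_eq I.primeCompl x
    rw [IsLocalization.mk'_mem_map_algebraMap_iff]
    refine ⟨1, one_mem _, ?_⟩
    rw [one_mul, RingHom.mem_ker, ← localizationConstantCoeff_algebraMap hI,
      ← IsLocalization.mk'_spec (Localization.AtPrime I) p s, map_mul, RingHom.mem_ker.1 hx,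
      zero_mul]
  · rwa [Ideal.mem_comap, RingHom.mem_ker, localizationConstantCoeff_algebraMap]

end MvPolynomial

/-- A commutative noetherian local ring `(R,𝔪)` is Tor-persistent if and only if the
localization of the polynomial ring `R[X₁, …, Xₙ]` at the maximal ideal
`(𝔪, X₁, …, Xₙ)` is Tor-persistent (`n ≥ 1`). -/
theorem torPersistent_iff_localization_polynomial
    {R : Type u} [CommRing R] [IsNoetherianRing R] [IsLocalRing R]
    (n : ℕ) (hn : 1 ≤ n) (I : Ideal (MvPolynomial (Fin n) R))
    (hI : I = Ideal.span
      ((MvPolynomial.C '' ((IsLocalRing.maximalIdeal R : Set R))) ∪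
        Set.range MvPolynomial.X))
    (hmax : I.IsMaximal) :
    TorPersistent R ↔
      (letI := hmax.isPrime; TorPersistent (Localization.AtPrime I)) := by
  have := hmax.isPrime
  let φ := MvPolynomial.localizationConstantCoeff hI
  have hflat : Module.Flat R (Localization.AtPrime I) :=
    .trans R (MvPolynomial (Fin n) R) (Localization.AtPrime I)
  refine ⟨fun hR ↦ ?_, fun h ↦ h.of_flat_of_retraction φ⟩
  refine TorPersistent.of_isWeaklyRegular ?_
    ((MvPolynomial.isWeaklyRegular_map_X (List.nodup_finRange n)).of_isLocalization
      (Localization.AtPrime I) I.primeCompl) (φ := φ.toRingHom)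
    (fun r ↦ ⟨_, φ.commutes r⟩) ?_ hR
  · simp only [List.mem_map, List.mem_finRange, true_and, exists_exists_eq_and,
      forall_exists_index, forall_apply_eq_imp_iff]
    exact fun i ↦ (IsLocalization.AtPrime.to_map_mem_maximal_iff _ I _).2
      (MvPolynomial.X_mem_of_eq_span hI i)
  · rw [← Ideal.map_ofList, MvPolynomial.ofList_map_X]
    simp only [List.mem_finRange, Set.ofPred_true, Set.image_univ]
    exact MvPolynomial.ker_localizationConstantCoeff hI
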